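/- arXiv:2003.08584 — 2 statements merged into one kernel-verified Lean document; each statement's English description precedes it below -/
import Mathlib

section
/- Let m > 0, ν ≥ 0 and c > 0 with 2c/m ∈ (0, j_ν), and define y(x) = √x · J_ν((2/m)·c·x^{m/2}) for x ∈ (0, 1]. Then the function x ↦ x·y′(x)/y(x) is decreasing on (0, 1]; its supremum over (0, 1] equals its limit as x → 0⁺, which is (1 + νm)/2; and its infimum over (0, 1] equals y′(1)/y(1) = 1/2 + c·J′_ν(2c/m)/J_ν(2c/m). -/
open MeasureTheory Real Set Filter

/-- Bessel function of the first kind of real order `ν`, defined for `x > 0` by its series. -/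
noncomputable def besselJ (ν x : ℝ) : ℝ :=
  ∑' k : ℕ, (-1 : ℝ) ^ k * x ^ (2 * (k : ℝ) + ν) /
    (2 ^ (2 * (k : ℝ) + ν) * (Nat.factorial k : ℝ) * Real.Gamma ((k : ℝ) + 1 + ν))

/-- The function `y(x) = √x · J_ν((2/m)·c·x^{m/2})`. -/
noncomputable def yfun (ν m c : ℝ) (x : ℝ) : ℝ :=
  Real.sqrt x * besselJ ν (2 / m * c * x ^ (m / 2))

/-- The entire function `∑ (-1)^k s^k / (k! Γ(k+1+ν))`, through which
`J_ν(t) = (t/2)^ν * besselAux ν ((t/2)^2)`. -/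
noncomputable def besselAux (ν s : ℝ) : ℝ :=
  ∑' k : ℕ, (-1 : ℝ) ^ k * s ^ k / ((Nat.factorial k : ℝ) * Real.Gamma ((k : ℝ) + 1 + ν))

theorem Gamma_one_add_le {ν : ℝ} (hν : 0 ≤ ν) (k : ℕ) :
    Real.Gamma (1 + ν) ≤ Real.Gamma ((k : ℝ) + 1 + ν) := by
  induction k with
  | zero => simp
  | succ k ih =>
    have hk : (0 : ℝ) ≤ k := k.cast_nonneg
    have h : ((k + 1 : ℕ) : ℝ) + 1 + ν = ((k : ℝ) + 1 + ν) + 1 := by push_cast; ring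
    rw [h, Real.Gamma_add_one (by positivity)]
    nlinarith [Real.Gamma_pos_of_pos (show (0 : ℝ) < (k : ℝ) + 1 + ν by positivity)]

theorem norm_besselAux_term_le {ν : ℝ} (hν : 0 ≤ ν) {s R : ℝ} (hs : |s| ≤ R) (k : ℕ) :
    ‖(-1 : ℝ) ^ k * s ^ k / ((Nat.factorial k : ℝ) * Real.Gamma ((k : ℝ) + 1 + ν))‖ ≤
      (Real.Gamma (1 + ν))⁻¹ * (R ^ k / (Nat.factorial k : ℝ)) := by
  have hΓ : 0 < Real.Gamma (1 + ν) := Real.Gamma_pos_of_pos (by positivity)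
  have hΓk := hΓ.trans_le (Gamma_one_add_le hν k)
  have hR : 0 ≤ R := (abs_nonneg s).trans hs
  rw [norm_div, norm_mul, norm_mul, norm_pow, norm_pow, norm_neg, norm_one, one_pow, one_mul,
    Real.norm_eq_abs, Real.norm_of_nonneg hΓk.le, Real.norm_of_nonneg (Nat.cast_nonneg _)]
  calc |s| ^ k / ((Nat.factorial k : ℝ) * Real.Gamma ((k : ℝ) + 1 + ν))
      ≤ R ^ k / ((Nat.factorial k : ℝ) * Real.Gamma (1 + ν)) := by
        gcongr
        exact Gamma_one_add_le hν k
    _ = _ := by field_simp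

theorem summable_besselAux {ν : ℝ} (hν : 0 ≤ ν) (s : ℝ) : Summable fun k : ℕ =>
    (-1 : ℝ) ^ k * s ^ k / ((Nat.factorial k : ℝ) * Real.Gamma ((k : ℝ) + 1 + ν)) :=
  Summable.of_norm_bounded ((Real.summable_pow_div_factorial |s|).mul_left _)
    (norm_besselAux_term_le hν le_rfl)

theorem besselAux_term_deriv_succ (ν s : ℝ) (k : ℕ) :
    (-1 : ℝ) ^ (k + 1) * (((k + 1 : ℕ) : ℝ) * s ^ k) /
      ((Nat.factorial (k + 1) : ℝ) * Real.Gamma (((k + 1 : ℕ) : ℝ) + 1 + ν)) =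
    -((-1 : ℝ) ^ k * s ^ k /
      ((Nat.factorial k : ℝ) * Real.Gamma ((k : ℝ) + 1 + (ν + 1)))) := by
  have h : ((k + 1 : ℕ) : ℝ) + 1 + ν = (k : ℝ) + 1 + (ν + 1) := by push_cast; ring
  have hk : ((k + 1 : ℕ) : ℝ) ≠ 0 := by positivity
  rw [h, Nat.factorial_succ, Nat.cast_mul, pow_succ]
  rw [show (-1 : ℝ) ^ k * -1 * (((k + 1 : ℕ) : ℝ) * s ^ k) =
      ((k + 1 : ℕ) : ℝ) * (-((-1 : ℝ) ^ k * s ^ k)) by ring, mul_assoc,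
    mul_div_mul_left _ _ hk, neg_div]

theorem hasDerivAt_besselAux {ν : ℝ} (hν : 0 ≤ ν) (s : ℝ) :
    HasDerivAt (besselAux ν) (-besselAux (ν + 1) s) s := by
  have hν1 : 0 ≤ ν + 1 := by positivity
  set R : ℝ := |s| + 1
  have hbound : Summable fun k : ℕ => (Real.Gamma (1 + (ν + 1)))⁻¹ *
      (R ^ k / (Nat.factorial k : ℝ)) :=
    (Real.summable_pow_div_factorial R).mul_left _
  let u : ℕ → ℝ := fun k => Nat.casesOn k 0 fun k =>
    (Real.Gamma (1 + (ν + 1)))⁻¹ * (R ^ k / (Nat.factorial k : ℝ))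
  have hu : Summable u := (summable_nat_add_iff 1).1 hbound
  have hs : s ∈ Metric.ball (0 : ℝ) R := by
    simp [R]
  have key := hasDerivAt_tsum_of_isPreconnected (u := u) (t := Metric.ball (0 : ℝ) R)
    (g := fun (k : ℕ) (s : ℝ) =>
      (-1 : ℝ) ^ k * s ^ k / ((Nat.factorial k : ℝ) * Real.Gamma ((k : ℝ) + 1 + ν)))
    (g' := fun (k : ℕ) (s : ℝ) => (-1 : ℝ) ^ k * ((k : ℝ) * s ^ (k - 1)) /
      ((Nat.factorial k : ℝ) * Real.Gamma ((k : ℝ) + 1 + ν)))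
    hu Metric.isOpen_ball (convex_ball _ _).isPreconnected
    (fun k x _ => ((hasDerivAt_pow k x).const_mul _).div_const _)
    (fun k x hx => by
      cases k with
      | zero => simp [u]
      | succ k =>
        simp only [Nat.add_sub_cancel]
        rw [besselAux_term_deriv_succ, norm_neg]
        exact norm_besselAux_term_le hν1 (by simpa using (Metric.mem_ball.1 hx).le) k)
    hs (summable_besselAux hν s) hs
  refine HasDerivAt.congr_deriv (f := besselAux ν) key ?_
  have hsum := (summable_besselAux hν1 s).hasSum.neg
  refine HasSum.tsum_eq ?_
  rw [← hasSum_nat_add_iff' 1]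
  simpa only [Finset.range_one, Finset.sum_singleton, Nat.cast_zero, zero_mul, mul_zero, zero_div,
    sub_zero, Nat.add_sub_cancel, besselAux_term_deriv_succ, besselAux] using hsum

theorem besselAux_recurrence {ν : ℝ} (hν : 0 ≤ ν) (s : ℝ) :
    s * besselAux (ν + 1 + 1) s = (ν + 1) * besselAux (ν + 1) s - besselAux ν s := by
  have hν1 : 0 ≤ ν + 1 := by positivity
  have hν2 : 0 ≤ ν + 1 + 1 := by positivity
  have h0 := (summable_besselAux hν s).hasSum
  have h1 := (summable_besselAux hν1 s).hasSum
  have h2 := (summable_besselAux hν2 s).hasSum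
  refine (h2.mul_left s).unique ?_
  have h3 := (h1.mul_left (ν + 1)).sub h0
  rw [← hasSum_nat_add_iff' 1] at h3
  have hΓ : Real.Gamma (ν + 1) ≠ 0 := (Real.Gamma_pos_of_pos (by positivity)).ne'
  have hz : ∑ i ∈ Finset.range 1, ((ν + 1) * ((-1 : ℝ) ^ i * s ^ i /
      ((Nat.factorial i : ℝ) * Real.Gamma ((i : ℝ) + 1 + (ν + 1)))) -
      (-1 : ℝ) ^ i * s ^ i / ((Nat.factorial i : ℝ) * Real.Gamma ((i : ℝ) + 1 + ν))) = 0 := by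
    rw [Finset.sum_range_one, Nat.cast_zero, show (0 : ℝ) + 1 + (ν + 1) = (ν + 1) + 1 by ring,
      show (0 : ℝ) + 1 + ν = ν + 1 by ring, Real.Gamma_add_one (by positivity)]
    field_simp
    simp
  rw [hz, sub_zero] at h3
  refine Eq.mp (congrArg (HasSum · _) (funext fun k => ?_)) h3
  symm
  have hk : (0 : ℝ) ≤ k := k.cast_nonneg
  have hG : Real.Gamma ((k : ℝ) + 2 + ν) ≠ 0 := (Real.Gamma_pos_of_pos (by positivity)).ne'
  rw [show (k : ℝ) + 1 + (ν + 1 + 1) = ((k : ℝ) + 2 + ν) + 1 by ring,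
    show ((k + 1 : ℕ) : ℝ) + 1 + (ν + 1) = ((k : ℝ) + 2 + ν) + 1 by push_cast; ring,
    show ((k + 1 : ℕ) : ℝ) + 1 + ν = (k : ℝ) + 2 + ν by push_cast; ring,
    Real.Gamma_add_one (by positivity), Nat.factorial_succ]
  push_cast
  field_simp
  ring

theorem besselAux_zero (ν : ℝ) : besselAux ν 0 = (Real.Gamma (1 + ν))⁻¹ := by
  rw [besselAux, tsum_eq_single 0 fun k hk => by simp [hk]]
  simp

theorem besselAux_zero_pos {ν : ℝ} (hν : 0 ≤ ν) : 0 < besselAux ν 0 := by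
  rw [besselAux_zero]
  exact inv_pos.2 (Real.Gamma_pos_of_pos (by positivity))

theorem continuous_besselAux {ν : ℝ} (hν : 0 ≤ ν) : Continuous (besselAux ν) :=
  continuous_iff_continuousAt.2 fun s => (hasDerivAt_besselAux hν s).continuousAt

/-- A multiple of the Wronskian-type expression `(t^2 - ν^2) J^2 + (t J')^2`, which increases
with derivative proportional to `t J^2`. -/
theorem besselAux_quadratic_nonneg {ν : ℝ} (hν : 0 ≤ ν) {s : ℝ} (hs : 0 < s) :
    0 ≤ besselAux ν s ^ 2 - ν * besselAux ν s * besselAux (ν + 1) s +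
      s * besselAux (ν + 1) s ^ 2 := by
  have hν1 : 0 ≤ ν + 1 := by positivity
  have h0 := continuous_besselAux hν
  have h1 := continuous_besselAux hν1
  have hmono : MonotoneOn (fun s : ℝ => s ^ (ν + 1) * (besselAux ν s ^ 2 -
      ν * besselAux ν s * besselAux (ν + 1) s + s * besselAux (ν + 1) s ^ 2)) (Ici 0) := by
    refine monotoneOn_of_hasDerivWithinAt_nonneg (convex_Ici 0)
      (f' := fun s => s ^ ν * besselAux ν s ^ 2) ?_ ?_ ?_
    · refine ((Real.continuous_rpow_const hν1).mul ?_).continuousOn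
      fun_prop
    · intro x hx
      rw [interior_Ici, mem_Ioi] at hx
      have hd0 := hasDerivAt_besselAux hν x
      have hd1 := hasDerivAt_besselAux hν1 x
      have hr : HasDerivAt (fun s : ℝ => s ^ (ν + 1)) ((ν + 1) * x ^ ν) x := by
        simpa using Real.hasDerivAt_rpow_const (x := x) (p := ν + 1) (Or.inl hx.ne')
      have hd := hr.mul (((hd0.pow 2).sub ((hd0.const_mul ν).mul hd1)).add
        ((hasDerivAt_id x).mul (hd1.pow 2)))
      refine (hd.congr_deriv ?_).hasDerivWithinAt
      have hrec := besselAux_recurrence hν x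
      simp only [Pi.pow_apply, Pi.mul_apply, Pi.add_apply, Pi.sub_apply, id]
      rw [Real.rpow_add_one hx.ne']
      push_cast
      linear_combination (x ^ ν * (ν * besselAux ν x - 2 * x * besselAux (ν + 1) x)) * hrec
    · intro x hx
      rw [interior_Ici, mem_Ioi] at hx
      positivity
  have h := hmono self_mem_Ici (mem_Ici.2 hs.le) hs.le
  simp only [Real.zero_rpow (show ν + 1 ≠ 0 by positivity), zero_mul] at h
  exact nonneg_of_mul_nonneg_right h (Real.rpow_pos_of_pos hs _)

theorem monotoneOn_besselAux_ratio {ν S : ℝ} (hν : 0 ≤ ν)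
    (hpos : ∀ s ∈ Icc 0 S, 0 < besselAux ν s) :
    MonotoneOn (fun s => s * besselAux (ν + 1) s / besselAux ν s) (Icc 0 S) := by
  have hν1 : 0 ≤ ν + 1 := by positivity
  have h0 := continuous_besselAux hν
  have h1 := continuous_besselAux hν1
  refine monotoneOn_of_hasDerivWithinAt_nonneg (convex_Icc 0 S)
    (f' := fun s => (besselAux ν s ^ 2 - ν * besselAux ν s * besselAux (ν + 1) s +
      s * besselAux (ν + 1) s ^ 2) / besselAux ν s ^ 2) ?_ ?_ ?_
  · exact (continuous_id.mul h1).continuousOn.div h0.continuousOn fun s hs => (hpos s hs).ne'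
  · intro x hx
    have hd := ((hasDerivAt_id x).mul (hasDerivAt_besselAux hν1 x)).div
      (hasDerivAt_besselAux hν x) (hpos x (interior_subset hx)).ne'
    refine (hd.congr_deriv ?_).hasDerivWithinAt
    have hrec := besselAux_recurrence hν x
    simp only [Pi.mul_apply, id]
    congr 1
    linear_combination (-besselAux ν x) * hrec
  · intro x hx
    rw [interior_Icc] at hx
    have := besselAux_quadratic_nonneg hν hx.1
    positivity

theorem besselJ_eq {ν t : ℝ} (ht : 0 < t) :
    besselJ ν t = (t / 2) ^ ν * besselAux ν ((t / 2) ^ 2) := by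
  rw [besselJ, besselAux, ← tsum_mul_left]
  refine tsum_congr fun k => ?_
  rw [Real.rpow_add ht, Real.rpow_add two_pos, Real.div_rpow ht.le two_pos.le, 
    show (2 : ℝ) * k = ((2 * k : ℕ) : ℝ) by push_cast; rfl, Real.rpow_natCast, Real.rpow_natCast,
    ← pow_mul, div_pow]
  field_simp

theorem hasDerivAt_besselJ {ν t : ℝ} (hν : 0 ≤ ν) (ht : 0 < t) :
    HasDerivAt (besselJ ν) ((t / 2) ^ ν / t * (ν * besselAux ν ((t / 2) ^ 2) -
      2 * (t / 2) ^ 2 * besselAux (ν + 1) ((t / 2) ^ 2))) t := by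
  have ht2 : 0 < t / 2 := by positivity
  have hlin : HasDerivAt (fun t : ℝ => t / 2) (1 / 2) t := (hasDerivAt_id t).div_const 2
  have hd := (hlin.rpow_const (p := ν) (Or.inl ht2.ne')).mul
    ((hasDerivAt_besselAux hν ((t / 2) ^ 2)).comp t (hlin.pow 2))
  have heq : besselJ ν =ᶠ[nhds t] fun t => (t / 2) ^ ν * besselAux ν ((t / 2) ^ 2) := by
    filter_upwards [Ioi_mem_nhds ht] with x hx using besselJ_eq hx
  refine (HasDerivAt.congr_of_eventuallyEq hd heq).congr_deriv ?_
  rw [Real.rpow_sub_one ht2.ne']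
  simp only [Function.comp_apply, Pi.pow_apply]
  field_simp
  push_cast
  ring

theorem mul_deriv_besselJ_div {ν t : ℝ} (hν : 0 ≤ ν) (ht : 0 < t) (hJ : besselJ ν t ≠ 0) :
    t * deriv (besselJ ν) t / besselJ ν t =
      ν - 2 * ((t / 2) ^ 2 * besselAux (ν + 1) ((t / 2) ^ 2) / besselAux ν ((t / 2) ^ 2)) := by
  rw [(hasDerivAt_besselJ hν ht).deriv]
  rw [besselJ_eq ht] at hJ ⊢
  obtain ⟨h1, h2⟩ := mul_ne_zero_iff.1 hJ
  generalize (t / 2) ^ 2 = s at h2 ⊢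
  field_simp

theorem mul_deriv_yfun_div {ν m c x : ℝ} (hν : 0 ≤ ν) (hm : 0 < m) (hc : 0 < c) (hx : 0 < x)
    (hJ : besselJ ν (2 / m * c * x ^ (m / 2)) ≠ 0) :
    x * deriv (yfun ν m c) x / yfun ν m c x =
      1 / 2 + m / 2 * (2 / m * c * x ^ (m / 2) *
        deriv (besselJ ν) (2 / m * c * x ^ (m / 2)) / besselJ ν (2 / m * c * x ^ (m / 2))) := by
  have hxm : 0 < x ^ (m / 2) := Real.rpow_pos_of_pos hx _
  have ht : 0 < 2 / m * c * x ^ (m / 2) := by positivity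
  have hinner : HasDerivAt (fun x : ℝ => 2 / m * c * x ^ (m / 2))
      (2 / m * c * (m / 2 * x ^ (m / 2 - 1))) x :=
    (Real.hasDerivAt_rpow_const (Or.inl hx.ne')).const_mul _
  have hJd := (hasDerivAt_besselJ hν ht).differentiableAt.hasDerivAt
  have hd : HasDerivAt (yfun ν m c) _ x :=
    (Real.hasDerivAt_sqrt hx.ne').mul (HasDerivAt.comp_of_eq x hJd hinner rfl)
  rw [hd.deriv, yfun, Real.rpow_sub_one hx.ne']
  have hsq : 0 < √x := Real.sqrt_pos.2 hx
  generalize deriv (besselJ ν) (2 / m * c * x ^ (m / 2)) = D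
  generalize besselJ ν (2 / m * c * x ^ (m / 2)) = J at hJ ⊢
  generalize x ^ (m / 2) = w
  obtain ⟨r, hr, rfl⟩ : ∃ r : ℝ, r = √x ∧ x = r ^ 2 := ⟨√x, rfl, (Real.sq_sqrt hx.le).symm⟩
  rw [← hr] at hsq ⊢
  field_simp

theorem stmt_1 (m ν c jν : ℝ) (hm : 0 < m) (hν : 0 ≤ ν) (hc : 0 < c)
    (hjν_pos : 0 < jν) (hjν_zero : besselJ ν jν = 0)
    (hjν_first : ∀ t ∈ Set.Ioo 0 jν, 0 < besselJ ν t)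
    (hcm : 2 * c / m ∈ Set.Ioo 0 jν) :
    AntitoneOn (fun x => x * deriv (yfun ν m c) x / yfun ν m c x) (Set.Ioc 0 1) ∧
    Filter.Tendsto (fun x => x * deriv (yfun ν m c) x / yfun ν m c x)
      (nhdsWithin 0 (Set.Ioi 0)) (nhds ((1 + ν * m) / 2)) ∧
    sSup ((fun x => x * deriv (yfun ν m c) x / yfun ν m c x) '' Set.Ioc 0 1)
      = (1 + ν * m) / 2 ∧
    sInf ((fun x => x * deriv (yfun ν m c) x / yfun ν m c x) '' Set.Ioc 0 1)
      = deriv (yfun ν m c) 1 / yfun ν m c 1 ∧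
    deriv (yfun ν m c) 1 / yfun ν m c 1
      = 1 / 2 + c * deriv (besselJ ν) (2 * c / m) / besselJ ν (2 * c / m) := by
  set F : ℝ → ℝ := fun x => x * deriv (yfun ν m c) x / yfun ν m c x with hF
  set H : ℝ → ℝ := fun s => s * besselAux (ν + 1) s / besselAux ν s with hH
  set T : ℝ → ℝ := fun x => 2 / m * c * x ^ (m / 2) with hT
  have hT1 : T 1 = 2 * c / m := by simp only [hT, Real.one_rpow]; ring
  have hTpos : ∀ x : ℝ, 0 < x → 0 < T x := fun x hx => by
    have := Real.rpow_pos_of_pos hx (m / 2)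
    positivity
  have hTmono : ∀ x y : ℝ, 0 < x → x ≤ y → T x ≤ T y := fun x y hx hxy => by
    simp only [hT]
    gcongr
  have hJpos : ∀ x ∈ Ioc (0 : ℝ) 1, 0 < besselJ ν (T x) := fun x hx =>
    hjν_first _ ⟨hTpos x hx.1, (hTmono x 1 hx.1 hx.2).trans_lt (hT1 ▸ hcm.2)⟩
  have hpos : ∀ s ∈ Icc 0 ((T 1 / 2) ^ 2), 0 < besselAux ν s := by
    intro s hs
    rcases hs.1.eq_or_lt with rfl | hs0
    · exact besselAux_zero_pos hν
    have hr : 0 < √s := Real.sqrt_pos.2 hs0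
    have hle : √s ≤ T 1 / 2 := (Real.sqrt_le_left (by linarith [hTpos 1 one_pos])).2 hs.2
    have hJ := hjν_first (2 * √s) ⟨by positivity, by linarith [hcm.2]⟩
    rw [besselJ_eq (by positivity), mul_div_cancel_left₀ _ two_ne_zero, Real.sq_sqrt hs0.le] at hJ
    exact pos_of_mul_pos_right hJ (Real.rpow_nonneg hr.le _)
  have hmono : MonotoneOn H (Icc 0 ((T 1 / 2) ^ 2)) := monotoneOn_besselAux_ratio hν hpos
  have hFJ : ∀ x ∈ Ioc (0 : ℝ) 1,
      F x = 1 / 2 + m / 2 * (T x * deriv (besselJ ν) (T x) / besselJ ν (T x)) := fun x hx =>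
    mul_deriv_yfun_div hν hm hc hx.1 (hJpos x hx).ne'
  have hFH : ∀ x ∈ Ioc (0 : ℝ) 1, F x = (1 + ν * m) / 2 - m * H ((T x / 2) ^ 2) := by
    intro x hx
    rw [hFJ x hx, mul_deriv_besselJ_div hν (hTpos x hx.1) (hJpos x hx).ne']
    ring
  have hanti : AntitoneOn F (Ioc 0 1) := by
    intro x hx y hy hxy
    rw [hFH x hx, hFH y hy]
    have hx0 := hTpos x hx.1
    have hy0 := hTpos y hy.1
    have hxy' := hTmono x y hx.1 hxy
    have hx1 := hTmono x 1 hx.1 hx.2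
    have hy1 := hTmono y 1 hy.1 hy.2
    have := hmono (a := (T x / 2) ^ 2) (b := (T y / 2) ^ 2) ⟨by positivity, by gcongr⟩
      ⟨by positivity, by gcongr⟩ (by gcongr)
    gcongr
  have hev : Ioc (0 : ℝ) 1 ∈ nhdsWithin (0 : ℝ) (Ioi 0) := Ioc_mem_nhdsGT one_pos
  have hlim : Tendsto F (nhdsWithin 0 (Ioi 0)) (nhds ((1 + ν * m) / 2)) := by
    have hTc : Continuous fun x => (T x / 2) ^ 2 :=
      (((Real.continuous_rpow_const (by positivity)).const_mul _).div_const 2).pow 2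
    have hT0 : (T 0 / 2) ^ 2 = 0 := by
      simp [hT, Real.zero_rpow (show m / 2 ≠ 0 by positivity)]
    have hHc : ContinuousAt H 0 :=
      (continuous_id.mul (continuous_besselAux (by positivity))).continuousAt.div
        (continuous_besselAux hν).continuousAt (besselAux_zero_pos hν).ne'
    have hcomp : ContinuousAt (fun x => (1 + ν * m) / 2 - m * H ((T x / 2) ^ 2)) 0 :=
      continuousAt_const.sub (continuousAt_const.mul
        (ContinuousAt.comp_of_eq hHc hTc.continuousAt hT0))
    have h := hcomp.tendsto.mono_left (nhdsWithin_le_nhds (s := Ioi 0))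
    rw [hT0, show H 0 = 0 by simp [hH], mul_zero, sub_zero] at h
    refine h.congr' ?_
    filter_upwards [hev] with x hx using (hFH x hx).symm
  have hone : (1 : ℝ) ∈ Ioc (0 : ℝ) 1 := ⟨one_pos, le_rfl⟩
  have hF1 : F 1 = deriv (yfun ν m c) 1 / yfun ν m c 1 := by simp [hF]
  refine ⟨hanti, hlim, ?_, ?_, ?_⟩
  · refine IsLUB.csSup_eq ⟨?_, ?_⟩ ⟨_, mem_image_of_mem F hone⟩
    · rintro _ ⟨x, hx, rfl⟩
      refine ge_of_tendsto hlim ?_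
      filter_upwards [Ioc_mem_nhdsGT hx.1] with z hz using
        hanti ⟨hz.1, hz.2.trans hx.2⟩ hx hz.2
    · intro b hb
      refine le_of_tendsto hlim ?_
      filter_upwards [hev] with x hx using hb (mem_image_of_mem F hx)
  · rw [← hF1]
    refine IsLeast.csInf_eq ⟨mem_image_of_mem F hone, ?_⟩
    rintro _ ⟨x, hx, rfl⟩
    exact hanti hx hone hx.2
  · rw [← hF1, hFJ 1 hone, hT1]
    field_simp
end

section
/- Let m > 1, ν ∈ (0, 1/m], λ ∈ [0, (1 + νm)/2), and let c > 0 satisfy (1 − 2λ)·J_ν(2c/m) + 2c·J′_ν(2c/m) = 0 with 2c/m ∈ (0, j_ν). Let f be an absolutely continuous function on [0, 1] with f(0) = 0 and f′(x)/x ∈ L¹[0, 1]. Then ((1 − ν²m²)/4)·∫₀¹ |f(x)|/x² dx + (c² + (m − 1)(λ − λ²))·∫₀¹ |f(x)|/x^{2−m} dx ≤ ((1 + νm)/2 − λ²)·∫₀¹ |f′(x)|/x dx. -/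
open MeasureTheory Real Set Filter

/-- The entire function `∑ (-z)^k / (k! Γ(k+1+μ))`, for which
`besselJ μ x = (x / 2) ^ μ * besselClifford μ (x ^ 2 / 4)`. -/
noncomputable def besselClifford (μ z : ℝ) : ℝ :=
  ∑' k : ℕ, (-z) ^ k / ((Nat.factorial k : ℝ) * Real.Gamma ((k : ℝ) + 1 + μ))

lemma Gamma_one_add_le_Gamma_nat_add {μ : ℝ} (hμ : 0 < μ) (k : ℕ) :
    Real.Gamma (1 + μ) ≤ Real.Gamma ((k : ℝ) + 1 + μ) := by
  induction k with
  | zero => simp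
  | succ k ih =>
    have hpos : 0 < (k : ℝ) + 1 + μ := by positivity
    have h := Real.Gamma_add_one hpos.ne'
    have hG := Real.Gamma_pos_of_pos hpos
    have hk : (0 : ℝ) ≤ k := by positivity
    rw [show ((k + 1 : ℕ) : ℝ) + 1 + μ = (k : ℝ) + 1 + μ + 1 by push_cast; ring, h]
    nlinarith

lemma norm_besselClifford_term_le {μ : ℝ} (hμ : 0 < μ) (z : ℝ) (k : ℕ) :
    ‖(-z) ^ k / ((Nat.factorial k : ℝ) * Real.Gamma ((k : ℝ) + 1 + μ))‖ ≤
      |z| ^ k / (Nat.factorial k : ℝ) / Real.Gamma (1 + μ) := by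
  have hG : 0 < Real.Gamma (1 + μ) := Real.Gamma_pos_of_pos (by positivity)
  have hle := Gamma_one_add_le_Gamma_nat_add hμ k
  have hGk := hG.trans_le hle
  rw [Real.norm_eq_abs, abs_div, abs_pow, abs_neg, div_div,
    abs_of_pos (show 0 < (Nat.factorial k : ℝ) * Real.Gamma ((k : ℝ) + 1 + μ) by positivity)]
  gcongr

lemma summable_besselClifford {μ : ℝ} (hμ : 0 < μ) (z : ℝ) :
    Summable fun k : ℕ => (-z) ^ k / ((Nat.factorial k : ℝ) * Real.Gamma ((k : ℝ) + 1 + μ)) :=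
  Summable.of_norm_bounded ((Real.summable_pow_div_factorial |z|).div_const _)
    (norm_besselClifford_term_le hμ z)

lemma hasDerivAt_besselClifford {μ : ℝ} (hμ : 0 < μ) (z : ℝ) :
    HasDerivAt (besselClifford μ) (-besselClifford (μ + 1) z) z := by
  set R : ℝ := |z| + 1 with hR
  have hR0 : 0 < R := by positivity
  set g' : ℕ → ℝ → ℝ := fun k y => (k * (-y) ^ (k - 1) * (-1)) /
    ((Nat.factorial k : ℝ) * Real.Gamma ((k : ℝ) + 1 + μ)) with hg'
  have hshift : ∀ (k : ℕ) (y : ℝ), g' (k + 1) y = -((-y) ^ k /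
      ((Nat.factorial k : ℝ) * Real.Gamma ((k : ℝ) + 1 + (μ + 1)))) := by
    intro k y
    have hG : 0 < Real.Gamma ((k : ℝ) + 1 + (μ + 1)) := Real.Gamma_pos_of_pos (by positivity)
    simp only [hg', Nat.factorial_succ]
    rw [show ((k + 1 : ℕ) : ℝ) + 1 + μ = (k : ℝ) + 1 + (μ + 1) by push_cast; ring]
    push_cast
    field_simp
  have hsum : Summable (fun k : ℕ => R ^ k / (Nat.factorial k : ℝ) / Real.Gamma (1 + (μ + 1))) :=
    (Real.summable_pow_div_factorial R).div_const _
  set u : ℕ → ℝ := fun k => Nat.casesOn k 0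
    (fun k => R ^ k / (Nat.factorial k : ℝ) / Real.Gamma (1 + (μ + 1)))
  have hu : Summable u := (summable_nat_add_iff 1).1 hsum
  have hz : z ∈ Metric.ball (0 : ℝ) R := by simp [hR]
  have hd := hasDerivAt_tsum_of_isPreconnected (g := fun (k : ℕ) (y : ℝ) => (-y) ^ k /
      ((Nat.factorial k : ℝ) * Real.Gamma ((k : ℝ) + 1 + μ))) (g' := g') hu
    Metric.isOpen_ball (convex_ball (0 : ℝ) R).isPreconnected
    (fun k y _ => (((hasDerivAt_neg y).pow k).div_const _)) ?_ hz (summable_besselClifford hμ z) hz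
  · have hs' : Summable (fun k => g' k z) := by
      refine (summable_nat_add_iff 1).1 ?_
      simp only [hshift]
      exact (summable_besselClifford (by positivity) z).neg
    rw [hs'.tsum_eq_zero_add] at hd
    simp only [hshift, tsum_neg] at hd
    have h0 : g' 0 z = 0 := by simp [hg']
    rw [h0, zero_add] at hd
    exact hd
  · intro k y hy
    cases k with
    | zero => simp [hg', u]
    | succ k =>
      rw [hshift, norm_neg]
      refine (norm_besselClifford_term_le (by positivity) y k).trans ?_
      have hG : 0 < Real.Gamma (1 + (μ + 1)) := Real.Gamma_pos_of_pos (by positivity)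
      have : |y| ≤ R := by simpa using (Metric.mem_ball.1 hy).le
      change _ ≤ R ^ k / (Nat.factorial k : ℝ) / Real.Gamma (1 + (μ + 1))
      gcongr

lemma besselClifford_recurrence {μ : ℝ} (hμ : 0 < μ) (z : ℝ) :
    besselClifford μ z - (μ + 1) * besselClifford (μ + 1) z + z * besselClifford (μ + 2) z = 0 := by
  have h0 := summable_besselClifford hμ z
  have h1 := (summable_besselClifford (show 0 < μ + 1 by positivity) z).mul_left (μ + 1)
  have h01 := h0.sub h1
  have hdiff : besselClifford μ z - (μ + 1) * besselClifford (μ + 1) z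
      = -(z * besselClifford (μ + 2) z) := by
    unfold besselClifford
    rw [← tsum_mul_left, ← h0.tsum_sub h1, h01.tsum_eq_zero_add, ← tsum_mul_left, ← tsum_neg]
    have hG0 : Real.Gamma (1 + (μ + 1)) = (1 + μ) * Real.Gamma (1 + μ) := by
      rw [← Real.Gamma_add_one (by positivity)]; ring_nf
    have hG : 0 < Real.Gamma (1 + μ) := Real.Gamma_pos_of_pos (by positivity)
    have hzero : (-z) ^ 0 / ((Nat.factorial 0 : ℝ) * Real.Gamma (((0 : ℕ) : ℝ) + 1 + μ)) -
        (μ + 1) * ((-z) ^ 0 / ((Nat.factorial 0 : ℝ) *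
          Real.Gamma (((0 : ℕ) : ℝ) + 1 + (μ + 1)))) = 0 := by
      simp only [pow_zero, Nat.factorial_zero, Nat.cast_one, Nat.cast_zero, zero_add, one_mul]
      rw [hG0]
      field_simp
      ring
    rw [hzero, zero_add]
    refine tsum_congr fun k => ?_
    have hpos : 0 < (k : ℝ) + 2 + μ := by positivity
    have e1 : ((k + 1 : ℕ) : ℝ) + 1 + μ = (k : ℝ) + 2 + μ := by push_cast; ring
    have e2 : ((k + 1 : ℕ) : ℝ) + 1 + (μ + 1) = (k : ℝ) + 2 + μ + 1 := by push_cast; ring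
    have e3 : (k : ℝ) + 1 + (μ + 2) = (k : ℝ) + 2 + μ + 1 := by ring
    have hGk := Real.Gamma_pos_of_pos hpos
    rw [e1, e2, e3, Real.Gamma_add_one hpos.ne', Nat.factorial_succ]
    push_cast
    field_simp
    ring
  linarith

lemma besselJ_eq_rpow_mul_besselClifford (ν : ℝ) {x : ℝ} (hx : 0 < x) :
    besselJ ν x = (x / 2) ^ ν * besselClifford ν ((x / 2) ^ 2) := by
  unfold besselJ besselClifford
  rw [← tsum_mul_left]
  refine tsum_congr fun k => ?_
  have h2k : ∀ y : ℝ, 0 < y → y ^ (2 * (k : ℝ) + ν) = (y ^ 2) ^ k * y ^ ν := by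
    intro y hy
    rw [Real.rpow_add hy, ← pow_mul, ← Real.rpow_natCast y (2 * k)]
    push_cast
    rfl
  rw [h2k x hx, h2k 2 two_pos, neg_pow ((x / 2) ^ 2),
    Real.div_rpow hx.le zero_le_two, div_pow, div_pow]
  have : (0 : ℝ) < 2 ^ ν := by positivity
  field_simp

lemma deriv_besselJ {ν x : ℝ} (hν : 0 < ν) (hx : 0 < x) :
    x * deriv (besselJ ν) x = (x / 2) ^ ν *
      (ν * besselClifford ν ((x / 2) ^ 2) -
        2 * (x / 2) ^ 2 * besselClifford (ν + 1) ((x / 2) ^ 2)) := by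
  have hx2 : 0 < x / 2 := by positivity
  have hev : besselJ ν =ᶠ[nhds x] fun y => (y / 2) ^ ν * besselClifford ν ((y / 2) ^ 2) := by
    filter_upwards [lt_mem_nhds hx] with y hy using besselJ_eq_rpow_mul_besselClifford ν hy
  have hhalf : HasDerivAt (fun y : ℝ => y / 2) (1 / 2) x := (hasDerivAt_id x).div_const 2
  have hd := (hhalf.rpow_const (p := ν) (Or.inl hx2.ne')).mul
    ((hasDerivAt_besselClifford hν _).comp x (hhalf.pow 2))
  rw [hev.deriv_eq]
  refine (congrArg (x * ·) hd.deriv).trans ?_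
  simp only [Real.rpow_sub_one hx2.ne', Pi.pow_apply, Function.comp_apply]
  push_cast
  field_simp
  ring

lemma nonneg_of_rpow_mul_hasDerivAt {g g' : ℝ → ℝ} {s Z : ℝ} (hs : 0 < s)
    (hg : ∀ z, HasDerivAt g (g' z) z)
    (hnn : ∀ z ∈ Ioc 0 Z, 0 ≤ s * g z + z * g' z) {z : ℝ} (hz : z ∈ Ioc 0 Z) : 0 ≤ g z := by
  have hcont : Continuous fun y => y ^ s * g y :=
    (Real.continuous_rpow_const hs.le).mul
      (continuous_iff_continuousAt.2 fun y => (hg y).continuousAt)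
  have hmono : MonotoneOn (fun y => y ^ s * g y) (Icc 0 Z) := by
    refine monotoneOn_of_hasDerivWithinAt_nonneg (convex_Icc 0 Z) hcont.continuousOn
      (f' := fun y => s * y ^ (s - 1) * g y + y ^ s * g' y) ?_ ?_
    · intro y hy
      rw [interior_Icc] at hy
      exact ((Real.hasDerivAt_rpow_const (Or.inl hy.1.ne')).mul (hg y)).hasDerivWithinAt
    · intro y hy
      rw [interior_Icc] at hy
      have h := mul_nonneg (Real.rpow_nonneg hy.1.le (s - 1)) (hnn y ⟨hy.1, hy.2.le⟩)
      have e : y ^ s = y ^ (s - 1) * y := by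
        rw [Real.rpow_sub_one hy.1.ne', div_mul_cancel₀ _ hy.1.ne']
      calc (0 : ℝ) ≤ _ := h
        _ = _ := by simp only [e]; ring
  have h := hmono (left_mem_Icc.2 (hz.1.le.trans hz.2)) ⟨hz.1.le, hz.2⟩ hz.1.le
  simp only [Real.zero_rpow hs.ne', zero_mul] at h
  exact nonneg_of_mul_nonneg_right h (Real.rpow_pos_of_pos hz.1 s)

/-- The function `-z φ'(z) / φ(z)` for `φ = besselClifford ν`. -/
noncomputable def cliffordLogDeriv (ν z : ℝ) : ℝ :=
  z * besselClifford (ν + 1) z / besselClifford ν z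

lemma hasDerivAt_cliffordLogDeriv {ν z : ℝ} (hν : 0 < ν) (hz : 0 < z)
    (hp : 0 < besselClifford ν z) :
    HasDerivAt (cliffordLogDeriv ν)
      ((cliffordLogDeriv ν z ^ 2 - ν * cliffordLogDeriv ν z + z) / z) z := by
  have hq := hasDerivAt_besselClifford (show 0 < ν + 1 by positivity) z
  have hd := ((hasDerivAt_id z).mul hq).div (hasDerivAt_besselClifford hν z) hp.ne'
  refine hd.congr_deriv ?_
  have hrec := besselClifford_recurrence hν z
  rw [show ν + 1 + 1 = ν + 2 by ring]
  simp only [cliffordLogDeriv, id, Pi.mul_apply]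
  have hr : z * besselClifford (ν + 2) z =
    (ν + 1) * besselClifford (ν + 1) z - besselClifford ν z := by linarith
  field_simp
  linear_combination (-besselClifford ν z) * hr

lemma besselClifford_add_one_nonneg {ν Z : ℝ} (hν : 0 < ν)
    (hp : ∀ z ∈ Ioc 0 Z, 0 < besselClifford ν z) {z : ℝ} (hz : z ∈ Ioc 0 Z) :
    0 ≤ besselClifford (ν + 1) z := by
  refine nonneg_of_rpow_mul_hasDerivAt (s := ν + 1) (by positivity)
    (fun y => hasDerivAt_besselClifford (show 0 < ν + 1 by positivity) y) ?_ hz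
  intro y hy
  have hrec := besselClifford_recurrence hν y
  rw [show ν + 1 + 1 = ν + 2 by ring]
  linarith [hp y hy]

lemma cliffordLogDeriv_monotoneOn {ν Z : ℝ} (hν : 0 < ν)
    (hp : ∀ z ∈ Ioc 0 Z, 0 < besselClifford ν z) :
    MonotoneOn (cliffordLogDeriv ν) (Ioc 0 Z) := by
  have hN : ∀ z ∈ Ioc 0 Z, 0 ≤ z * besselClifford (ν + 1) z ^ 2
      - ν * (besselClifford ν z * besselClifford (ν + 1) z) + besselClifford ν z ^ 2 := by
    intro z hz
    have hpd := fun y => hasDerivAt_besselClifford hν y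
    have hqd := fun y => hasDerivAt_besselClifford (show 0 < ν + 1 by positivity) y
    refine nonneg_of_rpow_mul_hasDerivAt (s := ν + 1) (by positivity)
      (g := fun z => z * besselClifford (ν + 1) z ^ 2
      - ν * (besselClifford ν z * besselClifford (ν + 1) z) + besselClifford ν z ^ 2)
      (fun y => (((hasDerivAt_id y).mul ((hqd y).pow 2)).sub
        (((hpd y).mul (hqd y)).const_mul ν)).add ((hpd y).pow 2)) ?_ hz
    intro y hy
    have hr : y * besselClifford (ν + 2) y =
      (ν + 1) * besselClifford (ν + 1) y - besselClifford ν y := by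
      linarith [besselClifford_recurrence hν y]
    rw [show ν + 1 + 1 = ν + 2 by ring]
    simp only [id, Pi.pow_apply]
    refine (sq_nonneg (besselClifford ν y)).trans_eq ?_
    push_cast
    linear_combination (2 * y * besselClifford (ν + 1) y - ν * besselClifford ν y) * hr
  have hd : ∀ z ∈ Ioc 0 Z, HasDerivAt (cliffordLogDeriv ν)
      ((cliffordLogDeriv ν z ^ 2 - ν * cliffordLogDeriv ν z + z) / z) z :=
    fun z hz => hasDerivAt_cliffordLogDeriv hν hz.1 (hp z hz)
  refine monotoneOn_of_hasDerivWithinAt_nonneg (convex_Ioc 0 Z)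
    (fun z hz => (hd z hz).continuousAt.continuousWithinAt)
    (fun z hz => (hd z (interior_subset hz)).hasDerivWithinAt) ?_
  intro z hz
  replace hz := interior_subset hz
  have hpz := hp z hz
  have hz0 := hz.1
  have e : (cliffordLogDeriv ν z ^ 2 - ν * cliffordLogDeriv ν z + z) / z =
      (z * besselClifford (ν + 1) z ^ 2 - ν * (besselClifford ν z * besselClifford (ν + 1) z)
        + besselClifford ν z ^ 2) / besselClifford ν z ^ 2 := by
    unfold cliffordLogDeriv
    field_simp
  rw [e]
  exact div_nonneg (hN z hz) (sq_nonneg _)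

/-- Comparison for the Riccati equation `x V' = V - V² - A - c² x^m` with `V(1) = lam`:
the tail integral of `A / x² + c² x^(m-2)` is controlled by `V`. -/
lemma tail_integral_le_of_riccati {m A c lam : ℝ} (hm : 1 < m) {V : ℝ → ℝ}
    (hV : ∀ x ∈ Ioc (0 : ℝ) 1, HasDerivAt V ((V x - V x ^ 2 - A - c ^ 2 * x ^ m) / x) x)
    (hV1 : V 1 = lam) (hlam : 0 ≤ lam) (hVlam : ∀ x ∈ Ioc (0 : ℝ) 1, lam ≤ V x)
    {t : ℝ} (ht : t ∈ Ioc (0 : ℝ) 1) :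
    A * (1 / t - 1) + c ^ 2 * ((1 - t ^ (m - 1)) / (m - 1)) ≤
      V t / t - lam - lam ^ 2 * (1 / t - 1) := by
  have hm1 : m - 1 ≠ 0 := by linarith
  set P : ℝ → ℝ := fun x => V x / x + (A + lam ^ 2) * (-x⁻¹) + c ^ 2 * (x ^ (m - 1) / (m - 1))
  have hP : ∀ x ∈ Ioc (0 : ℝ) 1, HasDerivAt P ((lam ^ 2 - V x ^ 2) / x ^ 2) x := by
    intro x hx
    have hx0 : x ≠ 0 := hx.1.ne'
    have h := (((hV x hx).div (hasDerivAt_id x) hx0).add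
      ((hasDerivAt_inv hx0).neg.const_mul (A + lam ^ 2))).add
      (((Real.hasDerivAt_rpow_const (x := x) (p := m - 1) (Or.inl hx0)).div_const
        (m - 1)).const_mul (c ^ 2))
    refine h.congr_deriv ?_
    rw [Real.rpow_sub_one hx0, Real.rpow_sub_one hx0]
    simp only [id]
    field_simp
    ring
  have hanti : AntitoneOn P (Ioc 0 1) := by
    refine antitoneOn_of_hasDerivWithinAt_nonpos (convex_Ioc 0 1)
      (fun z hz => (hP z hz).continuousAt.continuousWithinAt)
      (fun z hz => (hP z (interior_subset hz)).hasDerivWithinAt) ?_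
    intro x hx
    replace hx := interior_subset hx
    have := hVlam x hx
    exact div_nonpos_of_nonpos_of_nonneg (by nlinarith) (sq_nonneg x)
  have h := hanti ht (right_mem_Ioc.2 zero_lt_one) ht.2
  simp only [P, hV1, Real.one_rpow, div_one, inv_one] at h
  rw [sub_div, one_div]
  linarith

lemma lintegral_Icc_one_eq_ofReal_sub {W U : ℝ → ℝ} (hW0 : ∀ x ∈ Ioc (0 : ℝ) 1, 0 ≤ W x)
    (hWc : ContinuousOn W (Ioc 0 1)) (hU : ∀ x ∈ Ioc (0 : ℝ) 1, HasDerivAt U (W x) x)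
    {t : ℝ} (ht : t ∈ Ioc (0 : ℝ) 1) :
    ∫⁻ x in Icc t 1, ENNReal.ofReal (W x) = ENNReal.ofReal (U 1 - U t) := by
  have hsub : Icc t 1 ⊆ Ioc (0 : ℝ) 1 := fun x hx => ⟨ht.1.trans_le hx.1, hx.2⟩
  have hint : IntegrableOn W (Icc t 1) := (hWc.mono hsub).integrableOn_Icc
  rw [← ofReal_integral_eq_lintegral_ofReal hint
    ((ae_restrict_iff' measurableSet_Icc).2 (ae_of_all _ fun x hx => hW0 x (hsub hx))),
    integral_Icc_eq_integral_Ioc, ← intervalIntegral.integral_of_le ht.2,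
    intervalIntegral.integral_eq_sub_of_hasDerivAt]
  · intro x hx
    rw [uIcc_of_le ht.2] at hx
    exact hU x (hsub hx)
  · exact (hint.mono_set (by rw [uIcc_of_le ht.2])).intervalIntegrable

/-- A weighted `L¹` Hardy inequality: if the tail integral `U 1 - U t` of the weight `W = U'` is
at most `C / t`, then `∫ |f| W ≤ C ∫ |f'| / x`. -/
lemma hardy_L1_of_tail_le {f f' W U : ℝ → ℝ} {C : ℝ} (hW : Measurable W)
    (hW0 : ∀ x ∈ Ioc (0 : ℝ) 1, 0 ≤ W x) (hWc : ContinuousOn W (Ioc 0 1))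
    (hU : ∀ x ∈ Ioc (0 : ℝ) 1, HasDerivAt U (W x) x)
    (hC : ∀ t ∈ Ioc (0 : ℝ) 1, U 1 - U t ≤ C / t) (hC0 : 0 ≤ C)
    (hf'int : IntegrableOn f' (Icc 0 1))
    (hf : ∀ x ∈ Icc (0 : ℝ) 1, f x = ∫ t in (0 : ℝ)..x, f' t)
    (hL1 : IntegrableOn (fun x => f' x / x) (Ioc 0 1)) :
    IntegrableOn (fun x => |f x| * W x) (Ioc 0 1) ∧
      ∫ x in Ioc (0 : ℝ) 1, |f x| * W x ≤ C * ∫ x in Ioc (0 : ℝ) 1, |f' x| / x := by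
  have hRint : IntegrableOn (fun x => C * (|f' x| / x)) (Ioc 0 1) := by
    refine (hL1.abs.const_mul C).congr ?_
    refine (ae_restrict_iff' measurableSet_Ioc).2 (ae_of_all _ fun x hx => ?_)
    simp only [abs_div, abs_of_pos hx.1]
  have hR0 : ∀ᵐ x ∂volume.restrict (Ioc (0 : ℝ) 1), 0 ≤ C * (|f' x| / x) :=
    (ae_restrict_iff' measurableSet_Ioc).2 (ae_of_all _ fun x hx =>
      mul_nonneg hC0 (div_nonneg (abs_nonneg _) hx.1.le))
  have hL0 : ∀ᵐ x ∂volume.restrict (Ioc (0 : ℝ) 1), 0 ≤ |f x| * W x :=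
    (ae_restrict_iff' measurableSet_Ioc).2 (ae_of_all _ fun x hx =>
      mul_nonneg (abs_nonneg _) (hW0 x hx))
  have hf'm : AEMeasurable f' (volume.restrict (Ioc (0 : ℝ) 1)) :=
    (hf'int.mono_set Ioc_subset_Icc_self).aestronglyMeasurable.aemeasurable
  have hfc : ContinuousOn f (Icc 0 1) := by
    have h := intervalIntegral.continuousOn_primitive_interval (a := (0 : ℝ)) (b := 1) (f := f')
      (μ := volume) (by rwa [uIcc_of_le zero_le_one])
    rw [uIcc_of_le zero_le_one] at h
    exact h.congr hf
  have hmeas : AEStronglyMeasurable (fun x => |f x| * W x) (volume.restrict (Ioc (0 : ℝ) 1)) :=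
    ((hfc.mono Ioc_subset_Icc_self).abs.mul hWc).aestronglyMeasurable measurableSet_Ioc
  set F : ℝ → ℝ → ENNReal := fun x t =>
    {p : ℝ × ℝ | p.2 ≤ p.1}.indicator (fun p => ENNReal.ofReal (W p.1) * ‖f' p.2‖ₑ) (x, t) with hF
  have hFm : AEMeasurable (Function.uncurry F)
      ((volume.restrict (Ioc (0 : ℝ) 1)).prod (volume.restrict (Ioc (0 : ℝ) 1))) :=
    ((hW.ennreal_ofReal.comp measurable_fst).aemeasurable.mul hf'm.enorm.comp_snd).indicator
      (measurableSet_le measurable_snd measurable_fst)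
  have hleft : ∀ x ∈ Ioc (0 : ℝ) 1, ENNReal.ofReal (|f x| * W x) ≤
      ∫⁻ t in Ioc (0 : ℝ) 1, F x t := by
    intro x hx
    have hfx : ENNReal.ofReal |f x| ≤ ∫⁻ t in Ioc 0 x, ‖f' t‖ₑ := by
      rw [hf x ⟨hx.1.le, hx.2⟩, intervalIntegral.integral_of_le hx.1.le, ← Real.norm_eq_abs,
        ofReal_norm]
      exact enorm_integral_le_lintegral_enorm _
    have e : ∀ t, F x t = (Iic x).indicator (fun t => ENNReal.ofReal (W x) * ‖f' t‖ₑ) t :=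
      fun t => rfl
    simp only [e]
    rw [lintegral_indicator measurableSet_Iic, Measure.restrict_restrict measurableSet_Iic,
      lintegral_const_mul' _ _ ENNReal.ofReal_ne_top,
      show Iic x ∩ Ioc 0 1 = Ioc 0 x by
        ext t; simp only [mem_inter_iff, mem_Iic, mem_Ioc]
        exact ⟨fun h => ⟨h.2.1, h.1⟩, fun h => ⟨h.2, h.1, h.2.trans hx.2⟩⟩,
      ENNReal.ofReal_mul (abs_nonneg _), mul_comm]
    gcongr
  have hright : ∀ t ∈ Ioc (0 : ℝ) 1, ∫⁻ x in Ioc (0 : ℝ) 1, F x t ≤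
      ENNReal.ofReal (C * (|f' t| / t)) := by
    intro t ht
    have e : ∀ x, F x t = (Ici t).indicator (fun x => ENNReal.ofReal (W x) * ‖f' t‖ₑ) x :=
      fun x => rfl
    simp only [e]
    rw [lintegral_indicator measurableSet_Ici, Measure.restrict_restrict measurableSet_Ici,
      lintegral_mul_const' _ _ enorm_ne_top,
      show Ici t ∩ Ioc 0 1 = Icc t 1 by
        ext x; simp only [mem_inter_iff, mem_Ici, mem_Ioc, mem_Icc]
        exact ⟨fun h => ⟨h.1, h.2.2⟩, fun h => ⟨h.1, ht.1.trans_le h.1, h.2⟩⟩,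
      lintegral_Icc_one_eq_ofReal_sub hW0 hWc hU ht, ← ofReal_norm, Real.norm_eq_abs,
      ← ENNReal.ofReal_mul' (abs_nonneg _)]
    refine ENNReal.ofReal_le_ofReal ?_
    calc (U 1 - U t) * |f' t| ≤ C / t * |f' t| :=
          mul_le_mul_of_nonneg_right (hC t ht) (abs_nonneg _)
      _ = C * (|f' t| / t) := by ring
  have hlin : ∫⁻ x in Ioc (0 : ℝ) 1, ENNReal.ofReal (|f x| * W x) ≤
      ENNReal.ofReal (C * ∫ x in Ioc (0 : ℝ) 1, |f' x| / x) := by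
    rw [← integral_const_mul, ofReal_integral_eq_lintegral_ofReal hRint hR0]
    calc ∫⁻ x in Ioc (0 : ℝ) 1, ENNReal.ofReal (|f x| * W x)
        ≤ ∫⁻ x in Ioc (0 : ℝ) 1, ∫⁻ t in Ioc (0 : ℝ) 1, F x t :=
          setLIntegral_mono' measurableSet_Ioc hleft
      _ = ∫⁻ t in Ioc (0 : ℝ) 1, ∫⁻ x in Ioc (0 : ℝ) 1, F x t := lintegral_lintegral_swap hFm
      _ ≤ ∫⁻ t in Ioc (0 : ℝ) 1, ENNReal.ofReal (C * (|f' t| / t)) :=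
          setLIntegral_mono' measurableSet_Ioc hright
  have hLint : IntegrableOn (fun x => |f x| * W x) (Ioc 0 1) :=
    ⟨hmeas, (hasFiniteIntegral_iff_ofReal hL0).2 (hlin.trans_lt ENNReal.ofReal_lt_top)⟩
  refine ⟨hLint, ?_⟩
  rw [← ofReal_integral_eq_lintegral_ofReal hLint hL0] at hlin
  refine (ENNReal.ofReal_le_ofReal_iff (mul_nonneg hC0 ?_)).1 hlin
  exact setIntegral_nonneg measurableSet_Ioc fun x hx => div_nonneg (abs_nonneg _) hx.1.le

lemma hasDerivAt_rpow_sub_one_div {m x : ℝ} (hm : 1 < m) (hx : 0 < x) :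
    HasDerivAt (fun x : ℝ => x ^ (m - 1) / (m - 1)) (x ^ (m - 2)) x := by
  have hm1 : m - 1 ≠ 0 := by linarith
  refine ((Real.hasDerivAt_rpow_const (p := m - 1) (Or.inl hx.ne')).div_const
    (m - 1)).congr_deriv ?_
  rw [show m - 1 - 1 = m - 2 by ring]
  field_simp

lemma hasDerivAt_neg_inv {x : ℝ} (hx : 0 < x) :
    HasDerivAt (fun x : ℝ => -x⁻¹) ((x ^ 2)⁻¹) x := by
  exact (hasDerivAt_inv hx.ne').neg.congr_deriv (neg_neg _)

/-- The tail bound for the weight `A / x² + B x^(m-2)` that is sufficient for the inequality. -/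
lemma bessel_tail_le {m ν lam c jν : ℝ} (hm : 1 < m) (hν : ν ∈ Ioc 0 (1 / m))
    (hlam : lam ∈ Ico 0 ((1 + ν * m) / 2)) (hc : 0 < c)
    (hjν_first : ∀ t ∈ Ioo 0 jν, 0 < besselJ ν t) (hcm : 2 * c / m ∈ Ioo 0 jν)
    (hroot : (1 - 2 * lam) * besselJ ν (2 * c / m) + 2 * c * deriv (besselJ ν) (2 * c / m) = 0)
    {t : ℝ} (ht : t ∈ Ioc (0 : ℝ) 1) :
    (1 - ν ^ 2 * m ^ 2) / 4 * (1 / t - 1) +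
      (c ^ 2 + (m - 1) * (lam - lam ^ 2)) * ((1 - t ^ (m - 1)) / (m - 1)) ≤
      ((1 + ν * m) / 2 - lam ^ 2) / t := by
  have hm0 : 0 < m := by linarith
  have hm1 : 0 < m - 1 := by linarith
  have hν0 : 0 < ν := hν.1
  set s : ℝ := c / m with hs
  have hs0 : 0 < s := by positivity
  have hcs : c = m * s := by rw [hs]; field_simp
  have hhalf : 2 * c / m / 2 = s := by rw [hs]; ring
  have hp : ∀ z ∈ Ioc 0 (s ^ 2), 0 < besselClifford ν z := by
    intro z hz
    have hsq : √z ≤ s := (Real.sqrt_le_left hs0.le).2 hz.2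
    have hsz : 0 < √z := Real.sqrt_pos.2 hz.1
    have hle : 2 * √z ≤ 2 * c / m := by rw [show 2 * c / m = 2 * s by rw [hs]; ring]; linarith
    have hJ := hjν_first (2 * √z) ⟨by positivity, hle.trans_lt hcm.2⟩
    rw [besselJ_eq_rpow_mul_besselClifford ν (by positivity), mul_div_cancel_left₀ _ two_ne_zero,
      Real.sq_sqrt hz.1.le] at hJ
    exact pos_of_mul_pos_right hJ (Real.rpow_nonneg hsz.le ν)
  have hps := hp (s ^ 2) ⟨by positivity, le_rfl⟩
  set V : ℝ → ℝ := fun x => (1 + ν * m) / 2 - m * cliffordLogDeriv ν (s ^ 2 * x ^ m) with hVdef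
  have hmem : ∀ x ∈ Ioc (0 : ℝ) 1, s ^ 2 * x ^ m ∈ Ioc 0 (s ^ 2) := fun x hx =>
    ⟨mul_pos (by positivity) (Real.rpow_pos_of_pos hx.1 m),
      mul_le_of_le_one_right (by positivity) (Real.rpow_le_one hx.1.le hx.2 hm0.le)⟩
  have hV1 : V 1 = lam := by
    have hd := deriv_besselJ hν0 hcm.1
    rw [hhalf] at hd
    rw [besselJ_eq_rpow_mul_besselClifford ν hcm.1, hhalf] at hroot
    have hsν : 0 < s ^ ν := Real.rpow_pos_of_pos hs0 ν
    have hd' : 2 * c * deriv (besselJ ν) (2 * c / m) =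
        m * (s ^ ν * (ν * besselClifford ν (s ^ 2) -
          2 * s ^ 2 * besselClifford (ν + 1) (s ^ 2))) := by
      rw [← hd]; field_simp
    rw [hd'] at hroot
    have hroot' : (1 - 2 * lam) * besselClifford ν (s ^ 2) + m * (ν * besselClifford ν (s ^ 2) -
          2 * s ^ 2 * besselClifford (ν + 1) (s ^ 2)) = 0 := by
      refine (mul_eq_zero.1 (?_ : s ^ ν * _ = 0)).resolve_left hsν.ne'
      linear_combination hroot
    simp only [hVdef, Real.one_rpow, mul_one, cliffordLogDeriv]
    field_simp
    linear_combination hroot'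
  have hVd : ∀ x ∈ Ioc (0 : ℝ) 1, HasDerivAt V
      ((V x - V x ^ 2 - (1 - ν ^ 2 * m ^ 2) / 4 - c ^ 2 * x ^ m) / x) x := by
    intro x hx
    have hx0 := hx.1
    have hxm : 0 < x ^ m := Real.rpow_pos_of_pos hx0 m
    have h := (((hasDerivAt_cliffordLogDeriv hν0 (hmem x hx).1 (hp _ (hmem x hx))).comp x
      ((Real.hasDerivAt_rpow_const (p := m) (Or.inl hx0.ne')).const_mul (s ^ 2))).const_mul
        m).const_sub ((1 + ν * m) / 2)
    refine h.congr_deriv ?_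
    simp only [hVdef]
    rw [Real.rpow_sub_one hx0.ne', hcs]
    field_simp
    ring
  have hmono := cliffordLogDeriv_monotoneOn hν0 hp
  have hVlam : ∀ x ∈ Ioc (0 : ℝ) 1, lam ≤ V x := by
    intro x hx
    have h := hmono (hmem x hx) ⟨by positivity, le_rfl⟩ (hmem x hx).2
    rw [← hV1]
    simp only [hVdef, Real.one_rpow, mul_one]
    nlinarith
  have hVle : V t ≤ (1 + ν * m) / 2 := by
    have h : 0 ≤ cliffordLogDeriv ν (s ^ 2 * t ^ m) :=
      div_nonneg (mul_nonneg (hmem t ht).1.le (besselClifford_add_one_nonneg hν0 hp (hmem t ht)))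
        (hp _ (hmem t ht)).le
    simp only [hVdef]
    nlinarith
  have hmain := tail_integral_le_of_riccati hm hVd hV1 hlam.1 hVlam ht
  have hVt : V t / t ≤ (1 + ν * m) / 2 / t := div_le_div_of_nonneg_right hVle ht.1.le
  have hνm : ν * m ≤ 1 := (le_div_iff₀ hm0).1 hν.2
  have hlam1 : lam ≤ 1 := by linarith [hlam.2]
  have hpow : 0 ≤ (lam - lam ^ 2) * t ^ (m - 1) :=
    mul_nonneg (by nlinarith [hlam.1]) (Real.rpow_nonneg ht.1.le _)
  have e1 : (c ^ 2 + (m - 1) * (lam - lam ^ 2)) * ((1 - t ^ (m - 1)) / (m - 1)) =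
      c ^ 2 * ((1 - t ^ (m - 1)) / (m - 1)) + (lam - lam ^ 2) * (1 - t ^ (m - 1)) := by
    field_simp
  have e2 : ((1 + ν * m) / 2 - lam ^ 2) / t = (1 + ν * m) / 2 / t - lam ^ 2 * (1 / t) := by ring
  rw [e1, e2]
  linarith
theorem stmt_5 (m ν lam c jν : ℝ) (f f' : ℝ → ℝ)
    (hm : 1 < m) (hν : ν ∈ Set.Ioc 0 (1 / m))
    (hlam : lam ∈ Set.Ico 0 ((1 + ν * m) / 2))
    (hc : 0 < c)
    (hjν_pos : 0 < jν) (hjν_zero : besselJ ν jν = 0)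
    (hjν_first : ∀ t ∈ Set.Ioo 0 jν, 0 < besselJ ν t)
    (hcm : 2 * c / m ∈ Set.Ioo 0 jν)
    (hroot : (1 - 2 * lam) * besselJ ν (2 * c / m)
      + 2 * c * deriv (besselJ ν) (2 * c / m) = 0)
    (hf'int : IntegrableOn f' (Set.Icc 0 1))
    (hf : ∀ x ∈ Set.Icc (0:ℝ) 1, f x = ∫ t in (0:ℝ)..x, f' t)
    (hL1 : IntegrableOn (fun x => f' x / x) (Set.Ioc 0 1)) :
    (1 - ν ^ 2 * m ^ 2) / 4 * (∫ x in Set.Ioc (0:ℝ) 1, |f x| / x ^ 2)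
      + (c ^ 2 + (m - 1) * (lam - lam ^ 2)) * (∫ x in Set.Ioc (0:ℝ) 1, |f x| / x ^ ((2:ℝ) - m))
    ≤ ((1 + ν * m) / 2 - lam ^ 2) * (∫ x in Set.Ioc (0:ℝ) 1, |f' x| / x) := by
  have hm0 : 0 < m := by linarith
  have hm1 : 0 < m - 1 := by linarith
  have hνm : ν * m ≤ 1 := (le_div_iff₀ hm0).1 hν.2
  have hνm0 : 0 < ν * m := mul_pos hν.1 hm0
  have hlam1 : lam ≤ 1 := by linarith [hlam.2]
  set A : ℝ := (1 - ν ^ 2 * m ^ 2) / 4 with hA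
  set B : ℝ := c ^ 2 + (m - 1) * (lam - lam ^ 2) with hB
  have hA0 : 0 ≤ A := by rw [hA]; nlinarith
  have hB0 : 0 ≤ B := add_nonneg (sq_nonneg c) (mul_nonneg hm1.le (by nlinarith [hlam.1]))
  have hK0 : 0 ≤ (1 + ν * m) / 2 - lam ^ 2 := by nlinarith [hlam.1, hlam.2]
  have hcInv : ContinuousOn (fun x : ℝ => (x ^ 2)⁻¹) (Ioc 0 1) :=
    (continuousOn_pow 2).inv₀ fun x hx => (pow_pos hx.1 2).ne'
  have hcPow : ContinuousOn (fun x : ℝ => x ^ (m - 2)) (Ioc 0 1) :=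
    continuousOn_id.rpow_const fun x hx => Or.inl hx.1.ne'
  have hInv := (hardy_L1_of_tail_le (f := f) (W := fun x => (x ^ 2)⁻¹) (C := 1) (by fun_prop)
    (fun x hx => by positivity) hcInv (fun x hx => hasDerivAt_neg_inv hx.1)
    (fun t ht => by simp) zero_le_one hf'int hf hL1).1
  have hPow := (hardy_L1_of_tail_le (f := f) (W := fun x => x ^ (m - 2)) (C := 1 / (m - 1))
    (by fun_prop) (fun x hx => Real.rpow_nonneg hx.1.le _) hcPow
    (fun x hx => hasDerivAt_rpow_sub_one_div hm hx.1)
    (fun t ht => by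
      have h1 : 0 ≤ t ^ (m - 1) / (m - 1) := div_nonneg (Real.rpow_nonneg ht.1.le _) hm1.le
      have h2 : 1 / (m - 1) ≤ 1 / (m - 1) / t := le_div_self (by positivity) ht.1 ht.2
      simp only [Real.one_rpow]
      linarith) (by positivity) hf'int hf hL1).1
  have hmain := (hardy_L1_of_tail_le (f := f) (W := fun x => A * (x ^ 2)⁻¹ + B * x ^ (m - 2))
    (C := (1 + ν * m) / 2 - lam ^ 2) (by fun_prop)
    (fun x hx => add_nonneg (by positivity) (mul_nonneg hB0 (Real.rpow_nonneg hx.1.le _)))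
    ((hcInv.const_mul A).add (hcPow.const_mul B))
    (fun x hx => ((hasDerivAt_neg_inv hx.1).const_mul A).add
      ((hasDerivAt_rpow_sub_one_div hm hx.1).const_mul B))
    (fun t ht => by
      refine le_trans (le_of_eq ?_) (bessel_tail_le hm hν hlam hc hjν_first hcm hroot ht)
      simp only [Pi.add_apply, Real.one_rpow]
      ring) hK0 hf'int hf hL1).2
  refine le_trans (le_of_eq ?_) hmain
  have e : ∀ x, |f x| * (A * (x ^ 2)⁻¹ + B * x ^ (m - 2)) =
      A * (|f x| * (x ^ 2)⁻¹) + B * (|f x| * x ^ (m - 2)) := fun x => by ring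
  simp only [e]
  rw [integral_add (hInv.const_mul A) (hPow.const_mul B), integral_const_mul, integral_const_mul]
  congr 2
  refine setIntegral_congr_fun measurableSet_Ioc fun x hx => ?_
  simp only [div_eq_mul_inv]
  rw [← Real.rpow_neg hx.1.le, neg_sub]
end
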